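/- Assume ρ ∈ (0,1). Define the whole-package award random variable A : ℝ² → ℝ by A = (−2c)·1_{C1(a*,b*)} + (2c)·1_{C2(a*,b*)}, i.e. A(p) equals Player I's net offer −2c when p is strictly closer to a* than to b*, equals Player II's net offer 2c when p is strictly closer to b*, and equals 0 on the (P-null) set of equidistant points. Then, with respect to the measure P, A has expectation ∫ A dP = 0 and variance ∫ A² dP − (∫ A dP)² = (π/2)·(σx² + 2ρσxσy + σy²). -/

import Mathlib

open MeasureTheory ProbabilityTheory Real

/-- The bivariate normal measure on ℝ × ℝ with mean (0,0), standard deviations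
`sx, sy` and correlation `ρ`, realized as the pushforward of two independent
standard gaussians. -/
noncomputable def binormal (sx sy ρ : ℝ) : Measure (ℝ × ℝ) :=
  Measure.map (fun z : ℝ × ℝ => (sx * z.1, sy * (ρ * z.1 + Real.sqrt (1 - ρ ^ 2) * z.2)))
    ((gaussianReal 0 1).prod (gaussianReal 0 1))

/-- The set of points strictly closer (in Euclidean distance) to `a` than to `b`. -/
def closerTo (a b : ℝ × ℝ) : Set (ℝ × ℝ) :=
  {p | (p.1 - a.1) ^ 2 + (p.2 - a.2) ^ 2 < (p.1 - b.1) ^ 2 + (p.2 - b.2) ^ 2}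

/-- The expected payoff (from Player I to Player II) when Player I offers `a`
and Player II offers `b`. -/
noncomputable def K (sx sy ρ : ℝ) (a b : ℝ × ℝ) : ℝ :=
  if a = b then a.1 + a.2
  else (a.1 + a.2) * ((binormal sx sy ρ) (closerTo a b)).toReal
    + (b.1 + b.2) * ((binormal sx sy ρ) (closerTo b a)).toReal

/-- The common optimal offer magnitude. -/
noncomputable def cstar (sx sy ρ : ℝ) : ℝ :=
  Real.sqrt (2 * Real.pi * (sx ^ 2 + 2 * ρ * sx * sy + sy ^ 2)) / 4

lemma mem_closerTo_neg_iff {c : ℝ} (hc : 0 < c) (p : ℝ × ℝ) :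
    p ∈ closerTo (-c, -c) (c, c) ↔ p.1 + p.2 < 0 := by
  simp only [closerTo, Set.mem_ofPred_eq]
  constructor <;> intro h <;> nlinarith

lemma mem_closerTo_pos_iff {c : ℝ} (hc : 0 < c) (p : ℝ × ℝ) :
    p ∈ closerTo (c, c) (-c, -c) ↔ 0 < p.1 + p.2 := by
  simp only [closerTo, Set.mem_ofPred_eq]
  constructor <;> intro h <;> nlinarith

lemma measurable_binormal_map (sx sy ρ : ℝ) :
    Measurable (fun z : ℝ × ℝ =>
      (sx * z.1, sy * (ρ * z.1 + Real.sqrt (1 - ρ ^ 2) * z.2))) := by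
  fun_prop

instance isProbabilityMeasure_binormal (sx sy ρ : ℝ) :
    IsProbabilityMeasure (binormal sx sy ρ) :=
  Measure.isProbabilityMeasure_map (measurable_binormal_map sx sy ρ).aemeasurable

/-- A centred bivariate normal measure is invariant under negation. -/
lemma map_neg_binormal (sx sy ρ : ℝ) :
    (binormal sx sy ρ).map (fun p => -p) = binormal sx sy ρ := by
  have hprod : ((gaussianReal 0 1).prod (gaussianReal 0 1)).map (fun z : ℝ × ℝ => -z) =
      (gaussianReal 0 1).prod (gaussianReal 0 1) := by
    have h := Measure.map_prod_map (gaussianReal 0 1) (gaussianReal 0 1)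
      (measurable_neg (G := ℝ)) (measurable_neg (G := ℝ))
    have hg : (gaussianReal 0 1).map (Neg.neg : ℝ → ℝ) = gaussianReal 0 1 := by
      simpa using gaussianReal_map_neg (μ := 0) (v := 1)
    rw [hg] at h
    exact h.symm
  unfold binormal
  conv_rhs => rw [← hprod]
  rw [Measure.map_map measurable_neg (measurable_binormal_map sx sy ρ),
    Measure.map_map (measurable_binormal_map sx sy ρ) measurable_neg]
  congr 1
  ext z
  · simp
  · simp; ring

lemma integral_binormal_eq_zero_of_odd {sx sy ρ : ℝ} {f : ℝ × ℝ → ℝ}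
    (hf : ∀ p, f (-p) = -f p) : ∫ p, f p ∂(binormal sx sy ρ) = 0 := by
  have h : ∫ p, f (-p) ∂(binormal sx sy ρ) = ∫ p, f p ∂(binormal sx sy ρ) := by
    conv_rhs => rw [← map_neg_binormal]
    exact ((MeasurableEquiv.neg (ℝ × ℝ)).measurableEmbedding.integral_map f).symm
  simp only [hf, integral_neg] at h
  linarith

lemma ae_add_ne_zero_binormal {sx sy ρ : ℝ} (hsy : sy ≠ 0) (hρ : ρ ∈ Set.Ioo (-1 : ℝ) 1) :
    ∀ᵐ p ∂(binormal sx sy ρ), p.1 + p.2 ≠ 0 := by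
  have hm : MeasurableSet {p : ℝ × ℝ | p.1 + p.2 ≠ 0} :=
    (measurableSet_eq_fun (by fun_prop) measurable_const).compl
  have hpre := measurable_binormal_map sx sy ρ hm
  have : NullSingletonClass (gaussianReal 0 1) := nullSingletonClass_gaussianReal one_ne_zero
  have hr : sy * Real.sqrt (1 - ρ ^ 2) ≠ 0 :=
    mul_ne_zero hsy (Real.sqrt_ne_zero'.2 (by nlinarith [hρ.1, hρ.2]))
  unfold binormal
  rw [ae_map_iff (measurable_binormal_map sx sy ρ).aemeasurable hm]
  refine (Measure.ae_prod_iff_ae_ae hpre).2 (.of_forall fun x => ?_)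
  refine ae_iff.2 ?_
  refine Set.Subsingleton.measure_zero (fun y hy y' hy' => ?_) _
  simp only [ne_eq, not_not, Set.mem_ofPred_eq] at hy hy'
  exact mul_left_cancel₀ hr (by linarith)

lemma cstar_radicand_pos {sx sy ρ : ℝ} (hsx : 0 < sx) (hsy : 0 < sy)
    (hρ : ρ ∈ Set.Ioo (-1 : ℝ) 1) : 0 < sx ^ 2 + 2 * ρ * sx * sy + sy ^ 2 := by
  nlinarith [sq_nonneg (sx - sy), mul_pos (mul_pos hsx hsy) (neg_lt_iff_pos_add.1 hρ.1)]

theorem whole_package_award_mean_variance (sx sy ρ : ℝ) (hsx : 0 < sx) (hsy : 0 < sy)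
    (hρ : ρ ∈ Set.Ioo (0 : ℝ) 1) :
    let c := cstar sx sy ρ
    let astar : ℝ × ℝ := (-c, -c)
    let bstar : ℝ × ℝ := (c, c)
    let A : ℝ × ℝ → ℝ := fun p =>
      Set.indicator (closerTo astar bstar) (fun _ => -(2 * c)) p +
        Set.indicator (closerTo bstar astar) (fun _ => 2 * c) p
    (∫ p, A p ∂(binormal sx sy ρ)) = 0 ∧
      (∫ p, (A p) ^ 2 ∂(binormal sx sy ρ)) - (∫ p, A p ∂(binormal sx sy ρ)) ^ 2 =
        Real.pi / 2 * (sx ^ 2 + 2 * ρ * sx * sy + sy ^ 2) := by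
  intro c astar bstar A
  have hρ' : ρ ∈ Set.Ioo (-1 : ℝ) 1 := ⟨by linarith [hρ.1], hρ.2⟩
  have hV := cstar_radicand_pos hsx hsy hρ'
  have hc : 0 < c := div_pos (Real.sqrt_pos.2 (by positivity)) (by norm_num)
  have hA : ∀ p : ℝ × ℝ, A p = (if p.1 + p.2 < 0 then -(2 * c) else 0) +
      (if 0 < p.1 + p.2 then 2 * c else 0) := by
    intro p
    classical
    simp only [A, astar, bstar, Set.indicator_apply, mem_closerTo_neg_iff hc,
      mem_closerTo_pos_iff hc]
  have hmean : ∫ p, A p ∂(binormal sx sy ρ) = 0 := by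
    refine integral_binormal_eq_zero_of_odd fun p => ?_
    rw [hA, hA]
    simp only [Prod.fst_neg, Prod.snd_neg]
    split_ifs <;> linarith
  have hsq : ∀ᵐ p ∂(binormal sx sy ρ), A p ^ 2 = (2 * c) ^ 2 := by
    filter_upwards [ae_add_ne_zero_binormal hsy.ne' hρ'] with p hp
    rw [hA]
    rcases lt_or_gt_of_ne hp with h | h
    · simp [h, h.not_gt]
    · simp [h, h.not_gt]
  have hc2 : (2 * c) ^ 2 = Real.pi / 2 * (sx ^ 2 + 2 * ρ * sx * sy + sy ^ 2) := by
    have := Real.sq_sqrt (x := 2 * Real.pi * (sx ^ 2 + 2 * ρ * sx * sy + sy ^ 2)) (by positivity)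
    simp only [c, cstar]
    linear_combination this / 4
  refine ⟨hmean, ?_⟩
  rw [hmean, integral_congr_ae hsq, integral_const, hc2]
  simp
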